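/- Let n ≥ 3 and let G be a Hamiltonian graph on n vertices containing the cycle C_n with edges {1,2},…,{n−1,n},{1,n}. With g = J(G) and a = J(P_n), the colon ideals satisfy (a : g) = (a : δ_{1,n}). -/

import Mathlib

open MvPolynomial

/-- `δ_{i,j} = x_i y_j − x_j y_i` in `R = k[x_1,…,x_n,y_1,…,y_n]`, where we realise `R` as
the polynomial ring over `k` with variables indexed by `Fin n ⊕ Fin n`
(`Sum.inl i ↦ x_i`, `Sum.inr i ↦ y_i`; vertices are numbered `0, …, n-1`). -/
noncomputable def delta (k : Type) [Field k] (n : ℕ) (i j : Fin n) :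
    MvPolynomial (Fin n ⊕ Fin n) k :=
  X (Sum.inl i) * X (Sum.inr j) - X (Sum.inl j) * X (Sum.inr i)

/-- The binomial edge ideal `J(G)` of a graph `G`. -/
noncomputable def beIdeal (k : Type) [Field k] (n : ℕ) (G : SimpleGraph (Fin n)) :
    Ideal (MvPolynomial (Fin n ⊕ Fin n) k) :=
  Ideal.span {f | ∃ i j : Fin n, G.Adj i j ∧ f = delta k n i j}

/-- `a = J(P_n)`: the binomial edge ideal of the path `P_n` on the vertices `0, …, n-1`
with edges `{t, t+1}`. -/
noncomputable def pathIdeal (k : Type) [Field k] (n : ℕ) :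
    Ideal (MvPolynomial (Fin n ⊕ Fin n) k) :=
  Ideal.span {f | ∃ (t : Fin n) (h : (t : ℕ) + 1 < n), f = delta k n t ⟨(t : ℕ) + 1, h⟩}

/-- The degree of the monomial with exponent `m` at the vertex `i`. -/
def vertexDeg {n : ℕ} (m : Fin n ⊕ Fin n →₀ ℕ) (i : Fin n) : ℕ :=
  m (Sum.inl i) + m (Sum.inr i)

/-- The exponents of the images of the variables under the toric map
`x_i ↦ w_i s_{b i}`, `y_i ↦ w_i`. -/
noncomputable def toricExp {n : ℕ} (b : Fin n → ℕ) : Fin n ⊕ Fin n → (Fin n ⊕ ℕ →₀ ℕ) :=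
  Sum.elim (fun i => Finsupp.single (Sum.inl i) 1 + Finsupp.single (Sum.inr (b i)) 1)
    (fun i => Finsupp.single (Sum.inl i) 1)

/-- The action on exponents of the toric map attached to the vertex labelling `b`. -/
noncomputable def toricWeight {n : ℕ} (b : Fin n → ℕ) :
    (Fin n ⊕ Fin n →₀ ℕ) →ₗ[ℕ] (Fin n ⊕ ℕ →₀ ℕ) :=
  Finsupp.linearCombination ℕ (toricExp b)

/-- The toric map `x_i ↦ w_i s_{b i}`, `y_i ↦ w_i`. -/
noncomputable def toricMap (k : Type) [Field k] {n : ℕ} (b : Fin n → ℕ) :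
    MvPolynomial (Fin n ⊕ Fin n) k →ₐ[k] MvPolynomial (Fin n ⊕ ℕ) k :=
  aeval fun v => monomial (toricExp b v) 1

/-- The label of a vertex `i`: the number of elements of `Z` before `i`. -/
def blockLabel {n : ℕ} (Z : Finset (Fin n)) (i : Fin n) : ℕ :=
  (Z.filter (· < i)).card

/-- The interior vertices of the path at which the exponent `m` has degree zero. -/
def interiorZeros {n : ℕ} (m : Fin n ⊕ Fin n →₀ ℕ) : Finset (Fin n) :=
  Finset.univ.filter fun i => 0 < (i : ℕ) ∧ (i : ℕ) + 1 < n ∧ vertexDeg m i = 0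

lemma toricMap_monomial (k : Type) [Field k] {n : ℕ} (b : Fin n → ℕ)
    (m : Fin n ⊕ Fin n →₀ ℕ) (c : k) :
    toricMap k b (monomial m c) = monomial (toricWeight b m) c := by
  rw [toricMap, aeval_monomial, toricWeight, Finsupp.linearCombination_apply,
    Finsupp.sum, monomial_sum_index, Finsupp.prod]
  simp [monomial_pow, MvPolynomial.algebraMap_eq]

lemma toricWeight_inl {n : ℕ} (b : Fin n → ℕ) (m : Fin n ⊕ Fin n →₀ ℕ) (i : Fin n) :
    toricWeight b m (Sum.inl i) = vertexDeg m i := by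
  rw [toricWeight, Finsupp.linearCombination_apply, Finsupp.sum_fintype _ _ (by simp),
    Fintype.sum_sum_type]
  simp [toricExp, vertexDeg, Finsupp.single_apply]

lemma toricWeight_inr {n : ℕ} (b : Fin n → ℕ) (m : Fin n ⊕ Fin n →₀ ℕ) (c : ℕ) :
    toricWeight b m (Sum.inr c) = ∑ i with b i = c, m (Sum.inl i) := by
  rw [toricWeight, Finsupp.linearCombination_apply, Finsupp.sum_fintype _ _ (by simp),
    Fintype.sum_sum_type]
  simp [toricExp, Finsupp.single_apply, Finset.sum_filter]

lemma toricWeight_single {n : ℕ} (b : Fin n → ℕ) (v : Fin n ⊕ Fin n) :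
    toricWeight b (Finsupp.single v 1) = toricExp b v := by
  simp [toricWeight]

/-- The relation `u_j δ_{i,l} = u_i δ_{j,l} + u_l δ_{i,j}` for `u = x` and `u = y`. -/
lemma X_mul_delta (k : Type) [Field k] {n : ℕ} (i j l : Fin n) :
    (X (Sum.inl j) * delta k n i l =
      X (Sum.inl i) * delta k n j l + X (Sum.inl l) * delta k n i j) ∧
    (X (Sum.inr j) * delta k n i l =
      X (Sum.inr i) * delta k n j l + X (Sum.inr l) * delta k n i j) := by
  constructor <;> · simp only [delta]; ring

lemma delta_swap (k : Type) [Field k] {n : ℕ} (i j : Fin n) :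
    delta k n j i = -delta k n i j := by
  simp only [delta]; ring

lemma monomial_mul_delta_mem_of_lt (k : Type) [Field k] {n : ℕ} (i : ℕ) (hi : i < n) (j : ℕ) :
    i < j → ∀ (hj : j < n) (m : Fin n ⊕ Fin n →₀ ℕ),
      (∀ l : Fin n, i < (l : ℕ) → (l : ℕ) < j → vertexDeg m l ≠ 0) →
      monomial m 1 * delta k n ⟨i, hi⟩ ⟨j, hj⟩ ∈ pathIdeal k n := by
  intro hij
  induction j, hij using Nat.le_induction with
  | base =>
    intro hj m _
    exact Ideal.mul_mem_left _ _ (Ideal.subset_span ⟨⟨i, hi⟩, hj, rfl⟩)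
  | succ j hij ih =>
    intro hj m hm
    have hjn : j < n := by omega
    have hstep : delta k n ⟨j, hjn⟩ ⟨j + 1, hj⟩ ∈ pathIdeal k n :=
      Ideal.subset_span ⟨⟨j, hjn⟩, hj, rfl⟩
    have key : ∀ (v w w' : Fin n ⊕ Fin n), m v ≠ 0 →
        (v = Sum.inl ⟨j, hjn⟩ ∨ v = Sum.inr ⟨j, hjn⟩) →
        X v * delta k n ⟨i, hi⟩ ⟨j + 1, hj⟩ =
          X w * delta k n ⟨j, hjn⟩ ⟨j + 1, hj⟩ + X w' * delta k n ⟨i, hi⟩ ⟨j, hjn⟩ →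
        monomial m 1 * delta k n ⟨i, hi⟩ ⟨j + 1, hj⟩ ∈ pathIdeal k n := by
      intro v w w' hv hvj hrel
      obtain ⟨p, rfl⟩ : ∃ p, m = p + Finsupp.single v 1 :=
        ⟨m - Finsupp.single v 1, (tsub_add_cancel_of_le
          (Finsupp.single_le_iff.2 (Nat.one_le_iff_ne_zero.2 hv))).symm⟩
      have hp : monomial p 1 * delta k n ⟨i, hi⟩ ⟨j, hjn⟩ ∈ pathIdeal k n := by
        refine ih hjn p fun l hl hlj => ?_
        have := hm l hl (by omega)
        have hne : l ≠ ⟨j, hjn⟩ := fun h => by simp [h] at hlj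
        rcases hvj with rfl | rfl <;>
          simpa [vertexDeg, Finsupp.single_apply, hne.symm] using this
      have : (monomial (p + Finsupp.single v 1) 1 : MvPolynomial (Fin n ⊕ Fin n) k) *
          delta k n ⟨i, hi⟩ ⟨j + 1, hj⟩ =
          monomial p 1 * X w * delta k n ⟨j, hjn⟩ ⟨j + 1, hj⟩ +
            X w' * (monomial p 1 * delta k n ⟨i, hi⟩ ⟨j, hjn⟩) := by
        have h1 : (monomial (p + Finsupp.single v 1) 1 : MvPolynomial (Fin n ⊕ Fin n) k) =
            monomial p 1 * X v := by simp [X, monomial_mul]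
        rw [h1, mul_assoc, hrel]; ring
      rw [this]
      exact Ideal.add_mem _ (Ideal.mul_mem_left _ _ hstep) (Ideal.mul_mem_left _ _ hp)
    have hdeg := hm ⟨j, hjn⟩ (by simpa using hij) (by simp)
    by_cases hx : m (Sum.inl ⟨j, hjn⟩) = 0
    · have hy : m (Sum.inr ⟨j, hjn⟩) ≠ 0 := by
        intro hy; exact hdeg (by simp [vertexDeg, hx, hy])
      exact key _ _ _ hy (Or.inr rfl) (X_mul_delta k _ _ _).2
    · exact key _ _ _ hx (Or.inl rfl) (X_mul_delta k _ _ _).1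

/-- A monomial involving every vertex strictly between `i` and `j` multiplies `δ_{i,j}` into
the binomial edge ideal of the path. -/
lemma monomial_mul_delta_mem (k : Type) [Field k] {n : ℕ} (i j : Fin n)
    (m : Fin n ⊕ Fin n →₀ ℕ)
    (hm : ∀ l, (i < l ∧ l < j) ∨ (j < l ∧ l < i) → vertexDeg m l ≠ 0) :
    monomial m 1 * delta k n i j ∈ pathIdeal k n := by
  rcases lt_trichotomy i j with h | h | h
  · exact monomial_mul_delta_mem_of_lt k i i.2 j h j.2 m fun l h1 h2 => hm l (Or.inl ⟨h1, h2⟩)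
  · subst h; simp [delta]
  · rw [delta_swap k j i, mul_neg]
    exact neg_mem (monomial_mul_delta_mem_of_lt k j j.2 i h i.2 m
      fun l h1 h2 => hm l (Or.inr ⟨h1, h2⟩))

/-- Monomials with the same toric weight are congruent modulo the binomial edge ideal of the
path, provided that vertices with the same label are joined through vertices of positive
degree. -/
lemma monomial_sub_mem_of_toricWeight_eq (k : Type) [Field k] {n : ℕ} (b : Fin n → ℕ)
    (m' m : Fin n ⊕ Fin n →₀ ℕ)
    (hb : ∀ i j, b i = b j → ∀ l, i < l → l < j → vertexDeg m l ≠ 0)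
    (hw : toricWeight b m = toricWeight b m') :
    (monomial m 1 - monomial m' 1 : MvPolynomial (Fin n ⊕ Fin n) k) ∈ pathIdeal k n := by
  induction hd : ∑ i, (m (Sum.inl i) - m' (Sum.inl i)) using Nat.strong_induction_on
    generalizing m with
  | _ d ih =>
  have hdeg : ∀ i, vertexDeg m i = vertexDeg m' i := fun i => by
    rw [← toricWeight_inl b, hw, toricWeight_inl]
  have hsum : ∀ c, ∑ i with b i = c, m (Sum.inl i) = ∑ i with b i = c, m' (Sum.inl i) :=
    fun c => by rw [← toricWeight_inr b, hw, toricWeight_inr]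
  by_cases hlt : ∃ i, m' (Sum.inl i) < m (Sum.inl i)
  · obtain ⟨i, hi⟩ := hlt
    obtain ⟨j, hjb, hj⟩ : ∃ j, b j = b i ∧ m (Sum.inl j) < m' (Sum.inl j) := by
      by_contra! hcon
      refine (Finset.sum_lt_sum (s := Finset.univ.filter (b · = b i)) ?_
        ⟨i, by simp, hi⟩).ne' (hsum (b i))
      intro j hj
      exact hcon j (by simpa using hj)
    have hij : i ≠ j := by rintro rfl; omega
    have hyj : 1 ≤ m (Sum.inr j) := by
      have := hdeg j
      simp only [vertexDeg] at this
      omega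
    obtain ⟨p, rfl⟩ : ∃ p, m = p + (Finsupp.single (Sum.inl i) 1 +
        Finsupp.single (Sum.inr j) 1) := by
      refine ⟨m - (Finsupp.single (Sum.inl i) 1 + Finsupp.single (Sum.inr j) 1),
        (tsub_add_cancel_of_le ?_).symm⟩
      intro v
      rcases v with l | l
      · by_cases h : i = l
        · subst h; simp; omega
        · simp [h]
      · by_cases h : j = l
        · subst h; simpa using hyj
        · simp [h]
    set q := p + (Finsupp.single (Sum.inl j) 1 + Finsupp.single (Sum.inr i) 1) with hq
    have hwq : toricWeight b q = toricWeight b (p + (Finsupp.single (Sum.inl i) 1 +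
        Finsupp.single (Sum.inr j) 1)) := by
      simp only [hq, map_add, toricWeight_single, toricExp, Sum.elim_inl, Sum.elim_inr, hjb]
      abel
    have hdq : ∀ l, vertexDeg q l = vertexDeg (p + (Finsupp.single (Sum.inl i) 1 +
        Finsupp.single (Sum.inr j) 1)) l := fun l => by
      rw [← toricWeight_inl b, hwq, toricWeight_inl]
    have h1 : (monomial q 1 - monomial m' 1 : MvPolynomial (Fin n ⊕ Fin n) k) ∈
        pathIdeal k n := by
      refine ih _ ?_ q (fun i j h l h1 h2 => by rw [hdq]; exact hb i j h l h1 h2)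
        (hwq.trans hw) rfl
      rw [← hd]
      refine Finset.sum_lt_sum (fun l _ => ?_) ⟨i, Finset.mem_univ _, ?_⟩
      · by_cases hl : j = l
        · subst hl
          simp [hq, hij] at hj ⊢
          omega
        · simp [hq, hl]
          omega
      · simp [hq, hij.symm] at hi ⊢
        omega
    have h2 : (monomial p 1 * delta k n i j : MvPolynomial (Fin n ⊕ Fin n) k) ∈
        pathIdeal k n := by
      refine monomial_mul_delta_mem k i j p fun l hl => ?_
      have hli : i ≠ l := by rintro rfl; rcases hl with h | h <;> simp at h
      have hlj : j ≠ l := by rintro rfl; rcases hl with h | h <;> simp at h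
      have := hl.elim (fun h => hb i j hjb.symm l h.1 h.2) (fun h => hb j i hjb l h.1 h.2)
      simpa [vertexDeg, hli, hlj] using this
    have h3 : (monomial (p + (Finsupp.single (Sum.inl i) 1 + Finsupp.single (Sum.inr j) 1)) 1 -
        monomial m' 1 : MvPolynomial (Fin n ⊕ Fin n) k) =
        monomial p 1 * delta k n i j + (monomial q 1 - monomial m' 1) := by
      have : (monomial p 1 * delta k n i j : MvPolynomial (Fin n ⊕ Fin n) k) =
          monomial (p + (Finsupp.single (Sum.inl i) 1 + Finsupp.single (Sum.inr j) 1)) 1 -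
            monomial q 1 := by
        simp [delta, hq, X, monomial_mul, mul_sub]
      rw [this]; ring
    rw [h3]
    exact Ideal.add_mem _ h2 h1
  · push Not at hlt
    have hx : ∀ i, m (Sum.inl i) = m' (Sum.inl i) := fun i =>
      (Finset.sum_eq_sum_iff_of_le (s := Finset.univ.filter (b · = b i))
        (fun j _ => hlt j)).1 (hsum (b i)) i (by simp)
    have : m = m' := by
      ext v
      rcases v with i | i
      · exact hx i
      · have := hdeg i
        simp only [vertexDeg, hx i] at this
        omega
    simp [this]

lemma vertexDeg_ne_zero_of_blockLabel_eq {n : ℕ} (m : Fin n ⊕ Fin n →₀ ℕ) (i j : Fin n)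
    (h : blockLabel (interiorZeros m) i = blockLabel (interiorZeros m) j) (l : Fin n)
    (hil : i < l) (hlj : l < j) : vertexDeg m l ≠ 0 := by
  intro h0
  refine (Finset.card_lt_card (Finset.ssubset_iff_of_subset ?_ |>.2 ⟨l, ?_, ?_⟩)).ne h
  · intro z hz
    simp only [Finset.mem_filter] at hz ⊢
    exact ⟨hz.1, hz.2.trans (hil.trans hlj)⟩
  · simp only [Finset.mem_filter, interiorZeros, Finset.mem_univ, true_and]
    refine ⟨⟨?_, ?_, h0⟩, hlj⟩ <;> omega
  · simp only [Finset.mem_filter, not_and, not_lt]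
    exact fun _ => hil.le

lemma toricMap_delta (k : Type) [Field k] {n : ℕ} (b : Fin n → ℕ) (i j : Fin n) :
    toricMap k b (delta k n i j) =
      monomial (toricExp b (Sum.inl i) + toricExp b (Sum.inr j)) 1 -
        monomial (toricExp b (Sum.inl j) + toricExp b (Sum.inr i)) 1 := by
  simp [toricMap, delta, monomial_mul]

/-- The ideal generated by a set of variables is prime. -/
lemma isPrime_span_X_image (k : Type) [Field k] {σ : Type} (s : Set σ) :
    (Ideal.span (X '' s) : Ideal (MvPolynomial σ k)).IsPrime := by
  have hinj : Function.Injective (Subtype.val : {v // v ∉ s} → σ) := Subtype.val_injective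
  have hker : (Ideal.span (X '' s) : Ideal (MvPolynomial σ k)) =
      RingHom.ker (killCompl (R := k) hinj) := by
    ext p
    rw [mem_ideal_span_X_image, RingHom.mem_ker]
    constructor
    · intro h
      ext u
      rw [coeff_killCompl, coeff_zero]
      by_contra hne
      obtain ⟨v, hv, h0⟩ := h _ (mem_support_iff.2 hne)
      exact h0 (Finsupp.mapDomain_of_notMem_range _ _ (by simpa using hv))
    · intro h m hm
      by_contra! hcon
      have hsub : (m.support : Set σ) ⊆ Set.range (Subtype.val : {v // v ∉ s} → σ) := by
        intro v hv
        simp only [Subtype.range_coe_subtype, Set.mem_ofPred_eq]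
        exact fun hvs => Finsupp.mem_support_iff.1 hv (hcon v hvs)
      have h0 := congrArg (coeff (m.comapDomain Subtype.val hinj.injOn)) h
      rw [coeff_killCompl, Finsupp.mapDomain_comapDomain _ hinj _ hsub, coeff_zero] at h0
      exact mem_support_iff.1 hm h0
  rw [hker]
  exact RingHom.ker_isPrime _

/-- The prime ideal generated by the variables `w_z` for `z ∈ Z`. -/
noncomputable abbrev vertexVarIdeal (k : Type) [Field k] {n : ℕ} (Z : Finset (Fin n)) :
    Ideal (MvPolynomial (Fin n ⊕ ℕ) k) :=
  Ideal.span (X '' (Sum.inl '' (Z : Set (Fin n))))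

lemma pathIdeal_le_comap_toricMap (k : Type) [Field k] {n : ℕ} (Z : Finset (Fin n)) :
    pathIdeal k n ≤ (vertexVarIdeal k Z).comap (toricMap k (blockLabel Z)) := by
  rw [pathIdeal, Ideal.span_le]
  rintro _ ⟨t, ht, rfl⟩
  simp only [SetLike.mem_coe, Ideal.mem_comap, toricMap_delta]
  have hmon : ∀ (z : Fin n) (v : Fin n ⊕ ℕ →₀ ℕ), z ∈ Z → v (Sum.inl z) ≠ 0 →
      (monomial v 1 : MvPolynomial (Fin n ⊕ ℕ) k) ∈ vertexVarIdeal k Z := by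
    intro z v hz hv
    rw [mem_ideal_span_X_image]
    intro u hu
    rw [Finset.mem_singleton.1 (support_monomial_subset hu)]
    exact ⟨Sum.inl z, ⟨z, hz, rfl⟩, hv⟩
  by_cases h : t ∈ Z
  · exact sub_mem (hmon t _ h (by simp [toricExp])) (hmon t _ h (by simp [toricExp]))
  · have : blockLabel Z ⟨t + 1, ht⟩ = blockLabel Z t := by
      unfold blockLabel
      congr 1
      ext z
      simp only [Finset.mem_filter, and_congr_right_iff, Fin.lt_def]
      intro hz
      have : (z : ℕ) ≠ t := fun he => h (Fin.ext he ▸ hz)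
      omega
    simp only [toricExp, Sum.elim_inl, Sum.elim_inr, this]
    rw [add_right_comm, add_comm (Finsupp.single (Sum.inl t) 1), add_right_comm, sub_self]
    exact zero_mem _

lemma toricMap_delta_notMem (k : Type) [Field k] {n : ℕ} (Z : Finset (Fin n)) (i j : Fin n)
    (hi : i ∉ Z) (hj : j ∉ Z) (hij : blockLabel Z i ≠ blockLabel Z j) :
    toricMap k (blockLabel Z) (delta k n i j) ∉ vertexVarIdeal k Z := by
  rw [toricMap_delta, mem_ideal_span_X_image]
  intro h
  have hne : toricExp (blockLabel Z) (Sum.inl j) + toricExp (blockLabel Z) (Sum.inr i) ≠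
      toricExp (blockLabel Z) (Sum.inl i) + toricExp (blockLabel Z) (Sum.inr j) := by
    intro h
    have := DFunLike.congr_fun h (Sum.inr (blockLabel Z i))
    simp [toricExp, hij.symm] at this
  obtain ⟨_, ⟨z, hz, rfl⟩, h0⟩ := h
    (toricExp (blockLabel Z) (Sum.inl i) + toricExp (blockLabel Z) (Sum.inr j))
    (by simp [mem_support_iff, coeff_monomial, hne])
  have hzi : i ≠ z := by rintro rfl; exact hi hz
  have hzj : j ≠ z := by rintro rfl; exact hj hz
  simp [toricExp, hzi, hzj] at h0

/-- The coefficients of a polynomial in `(J(P_n) : δ_{1,n})` sum to zero over each toric fibre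
of monomials missing an interior vertex. -/
lemma sum_coeff_toric_fiber_eq_zero (k : Type) [Field k] {n : ℕ} (hn : 0 < n)
    (r : MvPolynomial (Fin n ⊕ Fin n) k)
    (hr : r * delta k n ⟨0, hn⟩ ⟨n - 1, by omega⟩ ∈ pathIdeal k n)
    (m₀ : Fin n ⊕ Fin n →₀ ℕ) (hm₀ : (interiorZeros m₀).Nonempty) :
    ∑ m ∈ r.support with toricWeight (blockLabel (interiorZeros m₀)) m =
      toricWeight (blockLabel (interiorZeros m₀)) m₀, coeff m r = 0 := by
  set Z := interiorZeros m₀ with hZ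
  have hprime : (vertexVarIdeal k Z).IsPrime := isPrime_span_X_image k _
  have hlabel : blockLabel Z ⟨0, hn⟩ ≠ blockLabel Z ⟨n - 1, by omega⟩ := by
    obtain ⟨z, hz⟩ := hm₀
    have hz' := hz
    simp only [hZ, interiorZeros, Finset.mem_filter, Finset.mem_univ, true_and] at hz'
    refine (Finset.card_lt_card (Finset.ssubset_iff_of_subset ?_ |>.2 ⟨z, ?_, ?_⟩)).ne
    · intro u hu
      simp [Fin.lt_def] at hu
    · simp only [Finset.mem_filter, Fin.lt_def]
      exact ⟨hz, by omega⟩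
    · simp [Fin.lt_def]
  have hmem : toricMap k (blockLabel Z) r ∈ vertexVarIdeal k Z := by
    have := pathIdeal_le_comap_toricMap k Z hr
    rw [Ideal.mem_comap, map_mul] at this
    refine (hprime.mem_or_mem this).resolve_right (toricMap_delta_notMem k Z _ _ ?_ ?_ hlabel)
    · simp [hZ, interiorZeros]
    · simp only [hZ, interiorZeros, Finset.mem_filter]
      omega
  have hcoeff : coeff (toricWeight (blockLabel Z) m₀) (toricMap k (blockLabel Z) r) = 0 := by
    by_contra hne
    obtain ⟨_, ⟨z, hz, rfl⟩, h0⟩ :=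
      mem_ideal_span_X_image.1 hmem _ (mem_support_iff.2 hne)
    rw [toricWeight_inl] at h0
    simp only [hZ, interiorZeros, Finset.mem_coe, Finset.mem_filter] at hz
    exact h0 hz.2.2.2
  rw [← hcoeff]
  conv_rhs => rw [r.as_sum, map_sum, coeff_sum]
  rw [Finset.sum_filter]
  exact Finset.sum_congr rfl fun m _ => by rw [toricMap_monomial, coeff_monomial]

lemma interiorZeros_eq_of_toricWeight_eq {n : ℕ} (b : Fin n → ℕ) {m m' : Fin n ⊕ Fin n →₀ ℕ}
    (h : toricWeight b m = toricWeight b m') : interiorZeros m = interiorZeros m' := by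
  have : vertexDeg m = vertexDeg m' := funext fun i => by
    rw [← toricWeight_inl b, h, toricWeight_inl]
  simp only [interiorZeros, this]

/-- The part of an element of `(J(P_n) : δ_{1,n})` supported on monomials missing an interior
vertex lies in `J(P_n)`. -/
lemma sum_monomial_mem_pathIdeal (k : Type) [Field k] {n : ℕ} (hn : 0 < n)
    (r : MvPolynomial (Fin n ⊕ Fin n) k)
    (hr : r * delta k n ⟨0, hn⟩ ⟨n - 1, by omega⟩ ∈ pathIdeal k n) :
    ∑ m ∈ r.support with (interiorZeros m).Nonempty, monomial m (coeff m r) ∈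
      pathIdeal k n := by
  classical
  let key (m : Fin n ⊕ Fin n →₀ ℕ) :=
    (interiorZeros m, toricWeight (blockLabel (interiorZeros m)) m)
  rw [← Finset.sum_fiberwise_of_maps_to (g := key) fun m hm => Finset.mem_image_of_mem key hm]
  refine Ideal.sum_mem _ fun κ hκ => ?_
  obtain ⟨m₀, hm₀, rfl⟩ := Finset.mem_image.1 hκ
  have hne := (Finset.mem_filter.1 hm₀).2
  have hkey : ∀ m, key m = key m₀ ↔ toricWeight (blockLabel (interiorZeros m₀)) m =
      toricWeight (blockLabel (interiorZeros m₀)) m₀ := by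
    intro m
    constructor
    · intro h
      have h1 := congrArg Prod.fst h
      have h2 := congrArg Prod.snd h
      simp only [key] at h1 h2
      rwa [h1] at h2
    · intro h
      have hZ := interiorZeros_eq_of_toricWeight_eq _ h
      simp only [key, hZ, h]
  have hset : ((r.support.filter fun m => (interiorZeros m).Nonempty).filter
      fun m => key m = key m₀) = r.support.filter fun m =>
      toricWeight (blockLabel (interiorZeros m₀)) m =
        toricWeight (blockLabel (interiorZeros m₀)) m₀ := by
    ext m
    simp only [Finset.mem_filter, hkey, and_assoc, and_congr_right_iff, and_iff_right_iff_imp]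
    intro _ h
    rwa [interiorZeros_eq_of_toricWeight_eq _ h]
  rw [hset]
  have hsum := sum_coeff_toric_fiber_eq_zero k hn r hr m₀ hne
  set S := r.support.filter fun m => toricWeight (blockLabel (interiorZeros m₀)) m =
    toricWeight (blockLabel (interiorZeros m₀)) m₀ with hS
  have : ∑ m ∈ S, monomial m (coeff m r) =
      ∑ m ∈ S, C (coeff m r) * (monomial m 1 - monomial m₀ 1) := by
    simp only [mul_sub, Finset.sum_sub_distrib, ← Finset.sum_mul, ← map_sum, hsum]
    simp [C_mul_monomial]
  rw [this]
  refine Ideal.sum_mem _ fun m hm => Ideal.mul_mem_left _ _ ?_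
  have hw := (Finset.mem_filter.1 hm).2
  refine monomial_sub_mem_of_toricWeight_eq k _ m₀ m (fun i j h => ?_) hw
  rw [← interiorZeros_eq_of_toricWeight_eq _ hw] at h
  exact vertexDeg_ne_zero_of_blockLabel_eq m i j h

/-- If `r δ_{1,n} ∈ J(P_n)` then `r δ_{i,j} ∈ J(P_n)` for all `i`, `j`. -/
lemma mul_delta_mem_pathIdeal (k : Type) [Field k] {n : ℕ} (hn : 0 < n)
    (r : MvPolynomial (Fin n ⊕ Fin n) k)
    (hr : r * delta k n ⟨0, hn⟩ ⟨n - 1, by omega⟩ ∈ pathIdeal k n) (i j : Fin n) :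
    r * delta k n i j ∈ pathIdeal k n := by
  have hfull : (∑ m ∈ r.support with ¬ (interiorZeros m).Nonempty, monomial m (coeff m r)) *
      delta k n i j ∈ pathIdeal k n := by
    rw [Finset.sum_mul]
    refine Ideal.sum_mem _ fun m hm => ?_
    have hempty := Finset.not_nonempty_iff_eq_empty.1 (Finset.mem_filter.1 hm).2
    rw [← mul_one (coeff m r), ← C_mul_monomial, mul_assoc]
    refine Ideal.mul_mem_left _ _ (monomial_mul_delta_mem k i j m fun l hl h0 => ?_)
    have : l ∈ interiorZeros m := by
      simp only [interiorZeros, Finset.mem_filter, Finset.mem_univ, true_and]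
      refine ⟨?_, ?_, h0⟩ <;> omega
    simp [hempty] at this
  have hsplit := Finset.sum_filter_add_sum_filter_not r.support
    (fun m => (interiorZeros m).Nonempty) fun m => monomial m (coeff m r)
  rw [← r.as_sum] at hsplit
  have hmem := Ideal.add_mem _
    (Ideal.mul_mem_right (delta k n i j) _ (sum_monomial_mem_pathIdeal k hn r hr)) hfull
  rwa [← add_mul, hsplit] at hmem

/-- Let `G` be a Hamiltonian graph on `n ≥ 3` vertices containing the
cycle `C_n`.  With `g = J(G)` and `a = J(P_n)`, the colon ideals satisfy
`(a : g) = (a : δ_{1,n})` (where `δ_{1,n}` corresponds to the edge joining the first and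
last vertices of the path). -/
theorem stmt17 (n : ℕ) (hn : 3 ≤ n) (k : Type) [Field k] (G : SimpleGraph (Fin n))
    (hpath : ∀ (t : Fin n) (h : (t : ℕ) + 1 < n), G.Adj t ⟨(t : ℕ) + 1, h⟩)
    (hcyc : G.Adj ⟨0, by omega⟩ ⟨n - 1, by omega⟩) :
    Submodule.colon (pathIdeal k n) (beIdeal k n G) =
      Submodule.colon (pathIdeal k n)
        (Ideal.span {delta k n ⟨0, by omega⟩ ⟨n - 1, by omega⟩}) := by
  apply le_antisymm
  · refine Submodule.colon_mono le_rfl (Ideal.span_le.2 ?_)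
    rintro _ rfl
    exact Ideal.subset_span ⟨_, _, hcyc, rfl⟩
  · intro r hr
    have hr' := Submodule.mem_colon.1 hr _ (Ideal.subset_span rfl)
    rw [beIdeal, Submodule.mem_colon]
    intro p hp
    induction hp using Submodule.span_induction with
    | mem x hx =>
      obtain ⟨i, j, -, rfl⟩ := hx
      exact mul_delta_mem_pathIdeal k (by omega) r hr' i j
    | zero => simp
    | add x y _ _ hx hy => rw [smul_add]; exact add_mem hx hy
    | smul c x _ hx => rw [smul_comm]; exact Ideal.mul_mem_left _ c hx
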